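/- arXiv:2603.25030 — 4 statements merged into one kernel-verified Lean document; each statement's English description precedes it below -/
import Mathlib

section
/- Let G be a simple graph on a finite vertex set V with |V| = n ≥ 2 and all pairwise graph distances at most D, let a_1, …, a_k ∈ V be anchors, let m ≥ 1, η ∈ (0, 1), and let Φ : V → (Fin m → ℝ) have orthonormal columns. Define F(v) = ((dist_G(v, a_1), …, dist_G(v, a_k)), (η · ⌊Φ(v, j)² / η⌋)_{j ≤ m}). Then |F(V)| ≤ (D + 1)^k · (2/η)^m, and consequently if ε ∈ (0, 1) and (D + 1)^k · (2/η)^m ≤ n^{1−ε}, then every reconstruction map s satisfies |{v ∈ V : s(F(v)) = v}| ≤ n^{1−ε}, i.e., it errs on at least a (1 − n^{−ε}) fraction of the vertices. -/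
/-- A reconstruction map is correct on at most as many points as there are observations. -/
theorem ncard_setOf_reconstruct_eq_le {V β : Type*} [Finite V] (F : V → β) (s : β → V) :
    {v | s (F v) = v}.ncard ≤ (Set.range F).ncard :=
  (Set.ncard_le_ncard (fun v hv => ⟨F v, ⟨v, rfl⟩, hv⟩ : {v | s (F v) = v} ⊆ s '' Set.range F)
    (Set.toFinite _)).trans (Set.ncard_image_le (Set.finite_range F))

/-- Each entry of a unit vector has square at most one. -/
theorem sq_le_one_of_sum_mul_self_eq_one {V : Type*} [Fintype V] {f : V → ℝ}
    (hf : ∑ v, f v * f v = 1) (v : V) : f v ^ 2 ≤ 1 := by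
  rw [← hf, pow_two]
  exact Finset.single_le_sum (f := fun v => f v * f v) (fun _ _ => mul_self_nonneg _)
    (Finset.mem_univ v)

/-- The number of pairs of a bounded integer code and a quantized code with values in `[0, 1]`. -/
theorem ncard_range_prod_quantized_le {V : Type*} (D k m : ℕ) {η : ℝ} (hη0 : 0 < η) (hη1 : η < 1)
    (d : V → Fin k → ℕ) (hd : ∀ v i, d v i ≤ D) (x : V → Fin m → ℝ)
    (hx0 : ∀ v j, 0 ≤ x v j) (hx1 : ∀ v j, x v j ≤ 1) :
    ((Set.range fun v => (d v, fun j => η * (⌊x v j / η⌋ : ℝ))).ncard : ℝ)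
      ≤ ((D + 1 : ℕ) : ℝ) ^ k * (2 / η) ^ m := by
  classical
  set N : ℕ := ⌊1 / η⌋₊ + 1 with hN
  let S : Finset ((Fin k → ℕ) × (Fin m → ℝ)) :=
    Fintype.piFinset (fun _ => Finset.range (D + 1)) ×ˢ
      Fintype.piFinset (fun _ => (Finset.range N).image fun i : ℕ => η * (i : ℝ))
  have hsub : (Set.range fun v => (d v, fun j => η * (⌊x v j / η⌋ : ℝ))) ⊆ (S : Set _) := by
    rintro _ ⟨v, rfl⟩
    simp only [S, Finset.mem_coe, Finset.mem_product, Fintype.mem_piFinset, Finset.mem_range,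
      Finset.mem_image]
    refine ⟨fun i => Nat.lt_succ_of_le (hd v i), fun j => ⟨⌊x v j / η⌋₊, ?_, ?_⟩⟩
    · exact Nat.lt_succ_of_le (Nat.floor_mono (by gcongr; exact hx1 v j))
    · rw [natCast_floor_eq_intCast_floor (div_nonneg (hx0 v j) hη0.le)]
  have hcard : S.card ≤ (D + 1) ^ k * N ^ m := by
    simp only [S, Finset.card_product, Fintype.card_piFinset, Finset.prod_const, Finset.card_univ,
      Fintype.card_fin, Finset.card_range]
    gcongr
    exact Finset.card_image_le.trans (Finset.card_range N).le
  have hNle : (N : ℝ) ≤ 2 / η := by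
    have h1 : (⌊1 / η⌋₊ : ℝ) ≤ 1 / η := Nat.floor_le (by positivity)
    have h2 : 1 ≤ 1 / η := (one_le_div hη0).2 hη1.le
    have h3 : 2 / η = 1 / η + 1 / η := by ring
    rw [hN]
    push_cast
    linarith
  have hle := (Set.ncard_le_ncard hsub S.finite_toSet).trans
    ((Set.ncard_coe_finset S).le.trans hcard)
  calc _ ≤ (((D + 1) ^ k * N ^ m : ℕ) : ℝ) := by exact_mod_cast hle
    _ = ((D + 1 : ℕ) : ℝ) ^ k * (N : ℝ) ^ m := by push_cast; rfl
    _ ≤ _ := by gcongr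


/-- Simple graph `G` on finite `V` with `|V| = n ≥ 2` and all
pairwise distances at most `D`, anchors `a : Fin k → V`, `m ≥ 1`, `η ∈ (0,1)`
and `Φ : V → (Fin m → ℝ)` with orthonormal columns.  For the hybrid
observation map `F(v) = ((dist_G(v, a i))_i, (η ⌊Φ(v,j)²/η⌋)_j)` we have
`|F(V)| ≤ (D+1)^k (2/η)^m`; consequently, if `ε ∈ (0,1)` and
`(D+1)^k (2/η)^m ≤ n^{1−ε}`, then every reconstruction map `s` localizes at
most `n^{1−ε}` vertices correctly, i.e. errs on at least a `1 − n^{−ε}`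
fraction of the vertices. -/
theorem stmt_11 (V : Type) [Fintype V] (G : SimpleGraph V)
    (n : ℕ) (hn : Fintype.card V = n) (hn2 : 2 ≤ n)
    (D k : ℕ) (hD : ∀ u w : V, G.dist u w ≤ D) (a : Fin k → V)
    (m : ℕ) (hm : 1 ≤ m) (η : ℝ) (hη0 : 0 < η) (hη1 : η < 1)
    (Φ : V → (Fin m → ℝ))
    (horth : ∀ j j' : Fin m,
      ∑ v : V, Φ v j * Φ v j' = if j = j' then (1 : ℝ) else 0) :
    ((Set.range (fun v : V =>
        ((fun i : Fin k => G.dist v (a i)),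
         (fun j : Fin m => η * (⌊(Φ v j) ^ 2 / η⌋ : ℝ))))).ncard : ℝ)
      ≤ ((D + 1 : ℕ) : ℝ) ^ k * (2 / η) ^ m ∧
    (∀ ε : ℝ, 0 < ε → ε < 1 →
      ((D + 1 : ℕ) : ℝ) ^ k * (2 / η) ^ m ≤ (n : ℝ) ^ (1 - ε) →
      ∀ s : ((Fin k → ℕ) × (Fin m → ℝ)) → V,
        ({v : V | s ((fun i : Fin k => G.dist v (a i)),
            (fun j : Fin m => η * (⌊(Φ v j) ^ 2 / η⌋ : ℝ))) = v}.ncard : ℝ)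
          ≤ (n : ℝ) ^ (1 - ε) ∧
        1 - (n : ℝ) ^ (-ε)
          ≤ ({v : V | s ((fun i : Fin k => G.dist v (a i)),
              (fun j : Fin m => η * (⌊(Φ v j) ^ 2 / η⌋ : ℝ))) ≠ v}.ncard : ℝ)
              / n) := by
  have hbound := ncard_range_prod_quantized_le D k m hη0 hη1 (fun v i => G.dist v (a i))
    (fun v i => hD v (a i)) (fun v j => Φ v j ^ 2) (fun v j => sq_nonneg _)
    (fun v j => sq_le_one_of_sum_mul_self_eq_one (f := fun v => Φ v j)
      (by simpa using horth j j) v)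
  refine ⟨hbound, fun ε _ _ hε s => ?_⟩
  set F := fun v : V => ((fun i : Fin k => G.dist v (a i)),
    (fun j : Fin m => η * (⌊(Φ v j) ^ 2 / η⌋ : ℝ))) with hF
  change (({v | s (F v) = v}.ncard : ℕ) : ℝ) ≤ _ ∧
    _ ≤ (({v | s (F v) ≠ v}.ncard : ℕ) : ℝ) / n
  have hcorrect : (({v | s (F v) = v}.ncard : ℕ) : ℝ) ≤ (n : ℝ) ^ (1 - ε) :=
    (Nat.cast_le.2 (ncard_setOf_reconstruct_eq_le F s)).trans (hbound.trans hε)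
  refine ⟨hcorrect, ?_⟩
  have hn0 : (0 : ℝ) < n := by exact_mod_cast (by omega : 0 < n)
  have hadd : (({v | s (F v) = v}.ncard : ℕ) : ℝ) + ({v | s (F v) ≠ v}.ncard : ℕ) = n := by
    have h := Set.ncard_add_ncard_compl {v | s (F v) = v}
    rw [Nat.card_eq_fintype_card, hn] at h
    exact_mod_cast h
  rw [sub_eq_add_neg, Real.rpow_add hn0, Real.rpow_one] at hcorrect
  rw [le_div_iff₀ hn0]
  linarith
end

section
/- Let B be a finite set with b = |B| ≥ 2 and q : B → Z a function, and let M = |q(B)|. Suppose the quantized collision density satisfies Coll(B) ≥ c for a real c > 0 and the balance coefficient satisfies Bal(B) ≤ β for a real β ≥ 1. Then M ≤ β · b / (1 + (b − 1) · c), and consequently M ≤ β / c. -/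
/-- The number of ordered collisions of `q`, plus the number of points, is at most the number of
points times the largest occupancy. -/
theorem card_collisions_add_card_le {B Z : Type*} [Fintype B] [DecidableEq B] [DecidableEq Z]
    (q : B → Z) :
    ((Finset.univ ×ˢ Finset.univ).filter
        (fun p : B × B => p.1 ≠ p.2 ∧ q p.1 = q p.2)).card + Fintype.card B ≤
      Fintype.card B * (Finset.univ.image q).sup
        (fun z => (Finset.univ.filter (fun v : B => q v = z)).card) := by
  have fiber (u : B) : (Finset.univ.filter (fun v : B => u ≠ v ∧ q u = q v)).card + 1 ≤
      (Finset.univ.image q).sup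
        (fun z => (Finset.univ.filter (fun v : B => q v = z)).card) := by
    have h : Finset.univ.filter (fun v : B => u ≠ v ∧ q u = q v) =
        (Finset.univ.filter (fun v : B => q v = q u)).erase u := by
      ext v
      simp [eq_comm]
    rw [h, Finset.card_erase_add_one (by simp)]
    exact Finset.le_sup (f := fun z => (Finset.univ.filter (fun v : B => q v = z)).card)
      (Finset.mem_image_of_mem q (Finset.mem_univ u))
  have hsum := Finset.sum_le_card_nsmul Finset.univ _ _ fun u _ => fiber u
  rw [Finset.sum_add_distrib, Finset.sum_const, smul_eq_mul, smul_eq_mul, mul_one,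
    Finset.card_univ] at hsum
  rw [Finset.card_filter, Finset.sum_product]
  simpa only [← Finset.card_filter] using hsum

/-- Let `B` be finite with `b = |B| ≥ 2`, `q : B → Z`, and
`M = |q(B)|`.  If the quantized collision density (over ordered pairs)
satisfies `Coll(B) ≥ c` with `c > 0` and the balance coefficient satisfies
`Bal(B) ≤ β` with `β ≥ 1`, then `M ≤ β b / (1 + (b − 1) c)`, and consequently
`M ≤ β / c`. -/
theorem stmt_15 (B Z : Type) [Fintype B] [DecidableEq B] [DecidableEq Z]
    (q : B → Z) (b : ℕ) (hb : Fintype.card B = b) (hb2 : 2 ≤ b)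
    (M : ℕ) (hM : M = (Finset.univ.image q).card)
    (c β : ℝ) (hc : 0 < c) (hβ : 1 ≤ β)
    (hcoll : c ≤
      (((Finset.univ ×ˢ Finset.univ).filter
          (fun p : B × B => p.1 ≠ p.2 ∧ q p.1 = q p.2)).card : ℝ)
        / ((b : ℝ) * ((b : ℝ) - 1)))
    (hbal : (M : ℝ) / (b : ℝ) *
        (((Finset.univ.image q).sup
            (fun z => (Finset.univ.filter (fun v : B => q v = z)).card) : ℕ) : ℝ)
        ≤ β) :
    (M : ℝ) ≤ β * (b : ℝ) / (1 + ((b : ℝ) - 1) * c) ∧ (M : ℝ) ≤ β / c := by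
  have hbR : (2 : ℝ) ≤ b := by exact_mod_cast hb2
  have hcount := card_collisions_add_card_le q
  have hsup : (Finset.univ.image q).sup
      (fun z => (Finset.univ.filter (fun v : B => q v = z)).card) ≤ b :=
    Finset.sup_le fun z _ => hb ▸ Finset.card_le_univ _
  rw [hb] at hcount
  generalize (Finset.univ.image q).sup
    (fun z => (Finset.univ.filter (fun v : B => q v = z)).card) = N at *
  generalize ((Finset.univ ×ˢ Finset.univ).filter
    (fun p : B × B => p.1 ≠ p.2 ∧ q p.1 = q p.2)).card = K at *
  have hcountR : (K : ℝ) + b ≤ b * N := by exact_mod_cast hcount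
  have hsupR : (N : ℝ) ≤ b := by exact_mod_cast hsup
  rw [le_div_iff₀ (by nlinarith)] at hcoll
  have hN : 1 + ((b : ℝ) - 1) * c ≤ N := by
    refine le_of_mul_le_mul_left ?_ (by linarith : (0 : ℝ) < b)
    linarith
  have hc1 : c ≤ 1 := by
    refine le_of_mul_le_mul_left ?_ (by linarith : (0 : ℝ) < b - 1)
    linarith
  rw [div_mul_eq_mul_div, div_le_iff₀ (by linarith)] at hbal
  have hpos : 0 < 1 + ((b : ℝ) - 1) * c := by nlinarith
  have hmain : (M : ℝ) * (1 + ((b : ℝ) - 1) * c) ≤ β * b :=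
    (mul_le_mul_of_nonneg_left hN M.cast_nonneg).trans hbal
  refine ⟨(le_div_iff₀ hpos).2 hmain, (le_div_iff₀ hc).2 ?_⟩
  refine le_of_mul_le_mul_right ?_ (by linarith : (0 : ℝ) < b)
  have hbc : c * b ≤ 1 + ((b : ℝ) - 1) * c := by linarith
  calc (M : ℝ) * c * b = M * (c * b) := by ring
    _ ≤ M * (1 + ((b : ℝ) - 1) * c) := mul_le_mul_of_nonneg_left hbc M.cast_nonneg
    _ ≤ β * b := hmain
end

section
/- Let V be a finite set, T and Z types, d : V → T and q : V → Z functions, and F(v) = (d(v), q(v)). For t ∈ d(V) write B_t = {v ∈ V : d(v) = t} for the bucket of t, and let D = |d(V)| be the number of nonempty buckets. Suppose there are real constants c > 0 and β ≥ 1 such that for every t ∈ d(V), either |B_t| = 1, or |B_t| ≥ 2 together with Coll(B_t) ≥ c and Bal(B_t) ≤ β (collision density and balance computed with respect to q restricted to B_t). Then the image size satisfies |F(V)| ≤ D · (1 + β / c). -/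
/-- Quantized collision density of a code map `q` on a finite bucket `B`
(ordered pairs): `Coll(B) = |{(u,v) ∈ B×B : u ≠ v, q u = q v}| / (b(b−1))`
where `b = |B|`. -/
noncomputable def collDensity {V Z : Type} [DecidableEq V] [DecidableEq Z]
    (q : V → Z) (B : Finset V) : ℝ :=
  (((B ×ˢ B).filter (fun p : V × V => p.1 ≠ p.2 ∧ q p.1 = q p.2)).card : ℝ)
    / ((B.card : ℝ) * ((B.card : ℝ) - 1))

/-- Balance coefficient of a code map `q` on a finite bucket `B`:
`Bal(B) = (M(B)/|B|) · max_{z ∈ q(B)} N(z)` where `M(B) = |q(B)|` and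
`N(z) = |{v ∈ B : q v = z}|`. -/
noncomputable def balanceCoeff {V Z : Type} [DecidableEq V] [DecidableEq Z]
    (q : V → Z) (B : Finset V) : ℝ :=
  ((B.image q).card : ℝ) / (B.card : ℝ) *
    (((B.image q).sup (fun z => (B.filter (fun v => q v = z)).card) : ℕ) : ℝ)

/-- The largest occupancy of a code on the bucket `B`. -/
def maxOccupancy {V Z : Type} [DecidableEq V] [DecidableEq Z] (q : V → Z) (B : Finset V) : ℕ :=
  (B.image q).sup (fun z => (B.filter (fun v => q v = z)).card)

theorem card_fiber_le_maxOccupancy {V Z : Type} [DecidableEq V] [DecidableEq Z]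
    (q : V → Z) (B : Finset V) {u : V} (hu : u ∈ B) :
    (B.filter (fun v => q v = q u)).card ≤ maxOccupancy q B :=
  Finset.le_sup (f := fun z => (B.filter (fun v => q v = z)).card) (Finset.mem_image_of_mem q hu)

theorem maxOccupancy_le_card {V Z : Type} [DecidableEq V] [DecidableEq Z]
    (q : V → Z) (B : Finset V) : maxOccupancy q B ≤ B.card :=
  Finset.sup_le fun _ _ => Finset.card_filter_le _ _

theorem card_collisions_le {V Z : Type} [DecidableEq V] [DecidableEq Z]
    (q : V → Z) (B : Finset V) :
    ((B ×ˢ B).filter (fun p : V × V => p.1 ≠ p.2 ∧ q p.1 = q p.2)).card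
      ≤ B.card * (maxOccupancy q B - 1) := by
  rw [Finset.card_filter, Finset.sum_product, ← smul_eq_mul]
  refine Finset.sum_le_card_nsmul _ _ _ fun u hu => ?_
  rw [← Finset.card_filter]
  calc (B.filter (fun v => u ≠ v ∧ q u = q v)).card
      ≤ ((B.filter (fun v => q v = q u)).erase u).card := by
        refine Finset.card_le_card fun v hv => ?_
        simp only [Finset.mem_filter, Finset.mem_erase] at hv ⊢
        exact ⟨hv.2.1.symm, hv.1, hv.2.2.symm⟩
    _ = (B.filter (fun v => q v = q u)).card - 1 :=
        Finset.card_erase_of_mem (by simp [hu])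
    _ ≤ maxOccupancy q B - 1 := Nat.sub_le_sub_right (card_fiber_le_maxOccupancy q B hu) 1

theorem collDensity_le_maxOccupancy_div_card {V Z : Type} [DecidableEq V] [DecidableEq Z]
    (q : V → Z) (B : Finset V) (hB : 2 ≤ B.card) :
    collDensity q B ≤ (maxOccupancy q B : ℝ) / (B.card : ℝ) := by
  obtain ⟨u, hu⟩ : B.Nonempty := Finset.card_pos.mp (by omega)
  have hpos : 1 ≤ maxOccupancy q B :=
    (Finset.card_pos.mpr ⟨u, by simp [hu]⟩).trans_le (card_fiber_le_maxOccupancy q B hu)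
  have hle : (maxOccupancy q B : ℝ) ≤ B.card := by exact_mod_cast maxOccupancy_le_card q B
  have hcard : (2 : ℝ) ≤ B.card := by exact_mod_cast hB
  have hcoll : (((B ×ˢ B).filter (fun p : V × V => p.1 ≠ p.2 ∧ q p.1 = q p.2)).card : ℝ)
      ≤ B.card * ((maxOccupancy q B : ℝ) - 1) := by
    have h := card_collisions_le q B
    rw [← Nat.cast_le (α := ℝ)] at h
    push_cast [hpos] at h
    exact h
  unfold collDensity
  rw [div_le_div_iff₀ (by nlinarith) (by linarith)]
  have hb : (0 : ℝ) ≤ B.card := by linarith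
  calc _ ≤ (B.card * ((maxOccupancy q B : ℝ) - 1)) * B.card :=
        mul_le_mul_of_nonneg_right hcoll hb
    _ = B.card * (((maxOccupancy q B : ℝ) - 1) * B.card) := by ring
    _ ≤ B.card * ((maxOccupancy q B : ℝ) * (B.card - 1)) :=
        mul_le_mul_of_nonneg_left (by linarith) hb
    _ = _ := by ring

theorem card_image_mul_collDensity_le_balanceCoeff {V Z : Type} [DecidableEq V] [DecidableEq Z]
    (q : V → Z) (B : Finset V) (hB : 2 ≤ B.card) :
    ((B.image q).card : ℝ) * collDensity q B ≤ balanceCoeff q B :=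
  calc ((B.image q).card : ℝ) * collDensity q B
      ≤ (B.image q).card * ((maxOccupancy q B : ℝ) / B.card) :=
        mul_le_mul_of_nonneg_left (collDensity_le_maxOccupancy_div_card q B hB) (Nat.cast_nonneg _)
    _ = balanceCoeff q B := by
        unfold balanceCoeff maxOccupancy
        ring

theorem card_image_prodMk_le_sum {V T Z : Type} [Fintype V] [DecidableEq T] [DecidableEq Z]
    (d : V → T) (q : V → Z) :
    (Finset.univ.image (fun v : V => (d v, q v))).card
      ≤ ∑ t ∈ Finset.univ.image d,
        ((Finset.univ.filter (fun v : V => d v = t)).image q).card := by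
  rw [← Finset.card_sigma]
  refine Finset.card_le_card_of_injOn (fun p => ⟨p.1, p.2⟩) ?_ ?_
  · intro p hp
    obtain ⟨v, -, rfl⟩ := Finset.mem_image.mp (Finset.mem_coe.mp hp)
    simp only [Finset.mem_coe, Finset.mem_sigma, Finset.mem_image, Finset.mem_filter,
      Finset.mem_univ, true_and]
    exact ⟨⟨v, rfl⟩, v, rfl, rfl⟩
  · rintro ⟨a, b⟩ - ⟨a', b'⟩ - h
    simpa using h

/-- Let `V` be finite, `d : V → T` a bucketing map, `q : V → Z` a
code map, and `F(v) = (d v, q v)`.  Write `B_t = {v : d v = t}` and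
`D = |d(V)|`.  If there are constants `c > 0` and `β ≥ 1` such that every
nonempty bucket is either a singleton or has `Coll(B_t) ≥ c` and
`Bal(B_t) ≤ β`, then `|F(V)| ≤ D (1 + β/c)`. -/
theorem stmt_16 (V T Z : Type) [Fintype V] [DecidableEq V] [DecidableEq T]
    [DecidableEq Z] (d : V → T) (q : V → Z)
    (c β : ℝ) (hc : 0 < c) (hβ : 1 ≤ β)
    (hbucket : ∀ t ∈ Finset.univ.image d,
      (Finset.univ.filter (fun v : V => d v = t)).card = 1 ∨
      (2 ≤ (Finset.univ.filter (fun v : V => d v = t)).card ∧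
        c ≤ collDensity q (Finset.univ.filter (fun v : V => d v = t)) ∧
        balanceCoeff q (Finset.univ.filter (fun v : V => d v = t)) ≤ β)) :
    ((Finset.univ.image (fun v : V => (d v, q v))).card : ℝ)
      ≤ ((Finset.univ.image d).card : ℝ) * (1 + β / c) := by
  have hβc : 0 ≤ β / c := by positivity
  calc ((Finset.univ.image (fun v : V => (d v, q v))).card : ℝ)
      ≤ ∑ t ∈ Finset.univ.image d,
          (((Finset.univ.filter (fun v : V => d v = t)).image q).card : ℝ) := by
        exact_mod_cast card_image_prodMk_le_sum d q
    _ ≤ (Finset.univ.image d).card • (1 + β / c) := by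
        refine Finset.sum_le_card_nsmul _ _ _ fun t ht => ?_
        rcases hbucket t ht with h | ⟨hcard, hcoll, hbal⟩
        · have hle : (((Finset.univ.filter (fun v : V => d v = t)).image q).card : ℝ) ≤ 1 := by
            exact_mod_cast Finset.card_image_le.trans h.le
          linarith
        · have hle : (((Finset.univ.filter (fun v : V => d v = t)).image q).card : ℝ) ≤ β / c := by
            rw [le_div_iff₀ hc]
            exact (mul_le_mul_of_nonneg_left hcoll (Nat.cast_nonneg _)).trans
              ((card_image_mul_collDensity_le_balanceCoeff q _ hcard).trans hbal)
          linarith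
    _ = _ := nsmul_eq_mul _ _
end

section
/- Let V be a finite set with |V| = n ≥ 2, d : V → T and q : V → Z functions, F(v) = (d(v), q(v)), and D = |d(V)|. Suppose there are real constants c > 0 and β ≥ 1 such that every nonempty bucket B_t = {v ∈ V : d(v) = t} satisfies either |B_t| = 1, or |B_t| ≥ 2 together with Coll(B_t) ≥ c and Bal(B_t) ≤ β. If moreover ε ∈ (0, 1) and D · (1 + β / c) ≤ n^{1−ε}, then every reconstruction map s satisfies |{v ∈ V : s(F(v)) = v}| ≤ n^{1−ε}; equivalently, every reconstruction map errs on at least a (1 − n^{−ε}) fraction of the vertices. -/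
/-- The collision density of a bucket is at most its largest occupancy divided by its size. -/
lemma collDensity_le_sup_div {V Z : Type} [DecidableEq V] [DecidableEq Z]
    (q : V → Z) (B : Finset V) (hB : 2 ≤ B.card) :
    collDensity q B ≤
      (((B.image q).sup (fun z => (B.filter (fun v => q v = z)).card) : ℕ) : ℝ) / B.card := by
  set m := (B.image q).sup (fun z => (B.filter (fun v => q v = z)).card) with hm
  have hle : ∀ u ∈ B, (B.filter (fun v => q v = q u)).card ≤ m := fun u hu =>
    Finset.le_sup (f := fun z => (B.filter (fun v => q v = z)).card)
      (Finset.mem_image_of_mem q hu)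
  have hpairs : ((B ×ˢ B).filter (fun p : V × V => p.1 ≠ p.2 ∧ q p.1 = q p.2)).card
      ≤ (m - 1) * B.card := by
    refine Finset.card_le_mul_card_image_of_maps_to (f := Prod.fst) (fun p hp => ?_) _
      (fun u hu => ?_)
    · simp only [Finset.mem_filter, Finset.mem_product] at hp
      exact hp.1.1
    · have hmem : u ∈ B.filter (fun v => q v = q u) := by simp [hu]
      calc _ ≤ ((B.filter (fun v => q v = q u)).erase u).card := by
            refine Finset.card_le_card_of_injOn Prod.snd ?_ ?_
            · rintro ⟨x, y⟩ hp
              simp only [Finset.coe_filter, Finset.mem_filter, Finset.mem_product,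
                Set.mem_ofPred_eq] at hp
              obtain ⟨⟨⟨_, hy⟩, hne, hq⟩, rfl⟩ := hp
              simp [hy, hq, Ne.symm hne]
            · rintro ⟨x, y⟩ hp ⟨x', y'⟩ hp' h
              simp only [Finset.coe_filter, Set.mem_ofPred_eq] at hp hp'
              exact Prod.ext (hp.2.trans hp'.2.symm) h
        _ = (B.filter (fun v => q v = q u)).card - 1 := Finset.card_erase_of_mem hmem
        _ ≤ m - 1 := Nat.sub_le_sub_right (hle u hu) 1
  have hmB : m ≤ B.card := Finset.sup_le fun z _ => Finset.card_filter_le _ _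
  have hm1 : 1 ≤ m := by
    obtain ⟨u, hu⟩ := Finset.card_pos.mp (by omega : 0 < B.card)
    exact (Finset.card_pos.mpr ⟨u, by simp [hu]⟩).trans_le (hle u hu)
  have hb : (2 : ℝ) ≤ B.card := by exact_mod_cast hB
  have hmB' : (m : ℝ) ≤ B.card := by exact_mod_cast hmB
  have hpairs' : (((B ×ˢ B).filter (fun p : V × V => p.1 ≠ p.2 ∧ q p.1 = q p.2)).card : ℝ)
      ≤ ((m : ℝ) - 1) * B.card := by
    have := (Nat.cast_le (α := ℝ)).mpr hpairs
    rwa [Nat.cast_mul, Nat.cast_sub hm1, Nat.cast_one] at this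
  unfold collDensity
  rw [div_le_div_iff₀ (by nlinarith) (by linarith)]
  nlinarith [mul_le_mul_of_nonneg_right hpairs' (by linarith : (0 : ℝ) ≤ B.card),
    mul_nonneg (sub_nonneg.mpr hmB') (by linarith : (0 : ℝ) ≤ B.card)]

/-- A bucket with collision density at least `c` and balance at most `β` has at most `β / c`
distinct codes. -/
lemma card_image_le_div {V Z : Type} [DecidableEq V] [DecidableEq Z]
    (q : V → Z) (B : Finset V) (hB : 2 ≤ B.card) {c β : ℝ} (hc : 0 < c)
    (hcoll : c ≤ collDensity q B) (hbal : balanceCoeff q B ≤ β) :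
    ((B.image q).card : ℝ) ≤ β / c := by
  rw [le_div_iff₀ hc]
  calc ((B.image q).card : ℝ) * c
      ≤ (B.image q).card *
        ((((B.image q).sup (fun z => (B.filter (fun v => q v = z)).card) : ℕ) : ℝ) / B.card) := by
        gcongr
        exact hcoll.trans (collDensity_le_sup_div q B hB)
    _ = balanceCoeff q B := by unfold balanceCoeff; ring
    _ ≤ β := hbal

/-- Within a bucket, at most one vertex per code is localized correctly. -/
lemma card_localized_bucket_le {V T Z : Type} [Fintype V] [DecidableEq V] [DecidableEq T]
    [DecidableEq Z] (d : V → T) (q : V → Z) (s : T × Z → V) (t : T) :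
    ((Finset.univ.filter (fun v : V => s (d v, q v) = v)).filter (fun v => d v = t)).card
      ≤ ((Finset.univ.filter (fun v : V => d v = t)).image q).card := by
  refine Finset.card_le_card_of_injOn q (fun v hv => ?_) (fun v hv w hw h => ?_)
  · simp only [Finset.coe_filter, Set.mem_ofPred_eq] at hv
    exact Finset.mem_coe.mpr (Finset.mem_image_of_mem q (by simp [hv.2]))
  · simp only [Finset.coe_filter, Finset.mem_filter, Finset.mem_univ, true_and,
      Set.mem_ofPred_eq] at hv hw
    rw [← hv.1, ← hw.1, hv.2, hw.2, h]

/-- Let `|V| = n ≥ 2`, `d : V → T`, `q : V → Z`,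
`F(v) = (d v, q v)` and `D = |d(V)|`.  Suppose constants `c > 0` and `β ≥ 1`
are such that every nonempty bucket `B_t = {v : d v = t}` is either a
singleton or satisfies `Coll(B_t) ≥ c` and `Bal(B_t) ≤ β`.  If `ε ∈ (0,1)`
and `D (1 + β/c) ≤ n^{1−ε}`, then every reconstruction map `s` localizes at
most `n^{1−ε}` vertices correctly; equivalently it errs on at least a
`1 − n^{−ε}` fraction of the vertices. -/
theorem stmt_17 (V T Z : Type) [Fintype V] [DecidableEq V] [DecidableEq T]
    [DecidableEq Z] (n : ℕ) (hn : Fintype.card V = n) (hn2 : 2 ≤ n)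
    (d : V → T) (q : V → Z)
    (c β : ℝ) (hc : 0 < c) (hβ : 1 ≤ β)
    (hbucket : ∀ t ∈ Finset.univ.image d,
      (Finset.univ.filter (fun v : V => d v = t)).card = 1 ∨
      (2 ≤ (Finset.univ.filter (fun v : V => d v = t)).card ∧
        c ≤ collDensity q (Finset.univ.filter (fun v : V => d v = t)) ∧
        balanceCoeff q (Finset.univ.filter (fun v : V => d v = t)) ≤ β))
    (ε : ℝ) (hε0 : 0 < ε) (hε1 : ε < 1)
    (hbudget : ((Finset.univ.image d).card : ℝ) * (1 + β / c)
      ≤ (n : ℝ) ^ (1 - ε)) :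
    ∀ s : T × Z → V,
      (((Finset.univ.filter (fun v : V => s (d v, q v) = v)).card : ℝ)
          ≤ (n : ℝ) ^ (1 - ε)) ∧
      (1 - (n : ℝ) ^ (-ε)
          ≤ ((Finset.univ.filter (fun v : V => s (d v, q v) ≠ v)).card : ℝ)
              / (n : ℝ)) := by
  intro s
  have hlocal : ((Finset.univ.filter (fun v : V => s (d v, q v) = v)).card : ℝ)
      ≤ (n : ℝ) ^ (1 - ε) := by
    refine le_trans ?_ hbudget
    rw [Finset.card_eq_sum_card_fiberwise (f := d) (t := Finset.univ.image d)
      (fun v _ => by simp), Nat.cast_sum, ← nsmul_eq_mul]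
    refine Finset.sum_le_card_nsmul _ _ _ fun t ht => ?_
    refine (Nat.cast_le.mpr (card_localized_bucket_le d q s t)).trans ?_
    have hpos : 0 < β / c := by positivity
    rcases hbucket t ht with h1 | ⟨h2, hcoll, hbal⟩
    · have h := Finset.card_image_le (s := Finset.univ.filter (fun v : V => d v = t)) (f := q)
      rw [h1] at h
      have h' : (((Finset.univ.filter (fun v : V => d v = t)).image q).card : ℝ) ≤ 1 := by
        exact_mod_cast h
      linarith
    · linarith [card_image_le_div q _ h2 hc hcoll hbal]
  refine ⟨hlocal, ?_⟩
  have hn0 : (0 : ℝ) < n := by exact_mod_cast (by omega : 0 < n)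
  have hsplit := Finset.card_filter_add_card_filter_not (s := (Finset.univ : Finset V))
    (fun v : V => s (d v, q v) = v)
  rw [Finset.card_univ, hn] at hsplit
  have hsplit' : ((Finset.univ.filter (fun v : V => s (d v, q v) = v)).card : ℝ)
      + (Finset.univ.filter (fun v : V => s (d v, q v) ≠ v)).card = n := by
    exact_mod_cast hsplit
  have hpow : (n : ℝ) ^ (1 - ε) = n * (n : ℝ) ^ (-ε) := by
    rw [sub_eq_add_neg, Real.rpow_add hn0, Real.rpow_one]
  rw [le_div_iff₀ hn0]
  linarith
end
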